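/- arXiv:2211.07000 — 7 statements merged into one kernel-verified Lean document; each statement's English description precedes it below -/
import Mathlib

section
/- Suppose the sign of the edge {u,v} is flipped from − to +. If w ∈ N_{G⁺}(u) ∩ N_{G⁺}(v), then NonAgreement_{G⁺}(u,w) ≥ NonAgreement_{H⁺}(u,w). -/
open SimpleGraph

/-- `NonAgreement G x y = |N_G(x) Δ N_G(y)| / max(|N_G(x)|, |N_G(y)|)` as a rational number. -/
noncomputable def NonAgreement {V : Type*} [Fintype V] (G : SimpleGraph V) (x y : V) : ℚ :=
  ((symmDiff (G.neighborSet x) (G.neighborSet y)).ncard : ℚ) /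
    ((max (G.neighborSet x).ncard (G.neighborSet y).ncard : ℕ) : ℚ)

theorem stmt4 {V : Type*} [Fintype V] (G H : SimpleGraph V) (u v w : V)
    (huv : u ≠ v) (hnadj : ¬ G.Adj u v)
    (hH : H = G ⊔ fromEdgeSet {s(u, v)})
    (hwu : w ∈ G.neighborSet u) (hwv : w ∈ G.neighborSet v) :
    NonAgreement G u w ≥ NonAgreement H u w := by
  have hNu : H.neighborSet u = insert v (G.neighborSet u) := by
    ext x
    simp only [hH, mem_neighborSet, sup_adj, fromEdgeSet_adj, Set.mem_singleton_iff,
      Set.mem_insert_iff, Sym2.eq_iff]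
    grind
  have hNw : H.neighborSet w = G.neighborSet w := by
    have hwu_ne : w ≠ u := hwu.ne'
    have hwv_ne : w ≠ v := hwv.ne'
    ext x
    simp only [hH, mem_neighborSet, sup_adj, fromEdgeSet_adj, Set.mem_singleton_iff, Sym2.eq_iff]
    grind
  have hvw : v ∈ G.neighborSet w := hwv.symm
  have hpos : 0 < (G.neighborSet u).ncard := (Set.ncard_pos (Set.toFinite _)).2 ⟨w, hwu⟩
  have hnum : (symmDiff (insert v (G.neighborSet u)) (G.neighborSet w)).ncard ≤
      (symmDiff (G.neighborSet u) (G.neighborSet w)).ncard := by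
    refine Set.ncard_le_ncard (fun x hx => ?_) (Set.toFinite _)
    simp only [Set.mem_symmDiff, Set.mem_insert_iff] at hx ⊢
    grind
  have hden : (G.neighborSet u).ncard ≤ (insert v (G.neighborSet u)).ncard :=
    Set.ncard_le_ncard (Set.subset_insert _ _) (Set.toFinite _)
  rw [ge_iff_le, NonAgreement, NonAgreement, hNu, hNw]
  refine div_le_div₀ (by positivity) (by exact_mod_cast hnum) ?_ ?_
  · exact_mod_cast lt_max_of_lt_left hpos
  · exact_mod_cast max_le_max_right _ hden
end

section
/- Suppose the sign of the edge {u,v} is flipped from − to +. If w ∈ N_{G⁺}(u) \ N_{G⁺}(v), |N_{G⁺}(u)| < |N_{G⁺}(w)|, and w ≠ v, then NonAgreement_{G⁺}(u,w) < NonAgreement_{H⁺}(u,w). -/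
open SimpleGraph

theorem stmt5 {V : Type*} [Fintype V] (G H : SimpleGraph V) (u v w : V)
    (huv : u ≠ v) (hnadj : ¬ G.Adj u v)
    (hH : H = G ⊔ fromEdgeSet {s(u, v)})
    (hwu : w ∈ G.neighborSet u) (hwv : w ∉ G.neighborSet v)
    (hdeg : (G.neighborSet u).ncard < (G.neighborSet w).ncard) (hwne : w ≠ v) :
    NonAgreement G u w < NonAgreement H u w := by
  have hadj : G.Adj u w := hwu
  have hvw : ¬ G.Adj w v := fun h => hwv h.symm
  have huw : u ≠ w := hadj.ne
  have hNu : H.neighborSet u = insert v (G.neighborSet u) := by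
    ext x
    simp only [hH, mem_neighborSet, sup_adj, fromEdgeSet_adj, Set.mem_singleton_iff,
      Set.mem_insert_iff, Sym2.eq_iff]
    grind
  have hNw : H.neighborSet w = G.neighborSet w := by
    ext x
    simp only [hH, mem_neighborSet, sup_adj, fromEdgeSet_adj, Set.mem_singleton_iff,
      Sym2.eq_iff]
    grind
  have hsymm : symmDiff (insert v (G.neighborSet u)) (G.neighborSet w) =
      insert v (symmDiff (G.neighborSet u) (G.neighborSet w)) := by
    ext x
    simp only [Set.mem_symmDiff, Set.mem_insert_iff, mem_neighborSet]
    grind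
  have hv : v ∉ symmDiff (G.neighborSet u) (G.neighborSet w) := by
    simp [Set.mem_symmDiff, hnadj, hvw]
  have hvu : v ∉ G.neighborSet u := hnadj
  have hpos : (0 : ℚ) < (G.neighborSet w).ncard := by
    exact_mod_cast (Nat.zero_le _).trans_lt hdeg
  unfold NonAgreement
  rw [hNu, hNw, hsymm, Set.ncard_insert_of_notMem hv (Set.toFinite _),
    Set.ncard_insert_of_notMem hvu (Set.toFinite _), max_eq_right hdeg.le,
    max_eq_right (Nat.succ_le_of_lt hdeg)]
  gcongr
  exact Nat.lt_succ_self _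
end

section
/- Suppose the sign of the edge {u,v} is flipped from − to +. Let Threshold = |N_{G⁺}(u) Δ N_{G⁺}(w)|, and suppose w ∈ N_{G⁺}(u) \ N_{G⁺}(v), |N_{G⁺}(u)| ≥ |N_{G⁺}(w)|, and w ≠ v. Then: (a) Threshold < |N_{G⁺}(u)| implies NonAgreement_{G⁺}(u,w) < NonAgreement_{H⁺}(u,w); (b) Threshold = |N_{G⁺}(u)| implies NonAgreement_{G⁺}(u,w) = NonAgreement_{H⁺}(u,w); (c) Threshold > |N_{G⁺}(u)| implies NonAgreement_{G⁺}(u,w) > NonAgreement_{H⁺}(u,w). -/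
open SimpleGraph

section NewEdge

variable {V : Type*} {G : SimpleGraph V} {u v w : V}

theorem neighborSet_sup_fromEdgeSet_left (huv : u ≠ v) :
    (G ⊔ fromEdgeSet {s(u, v)}).neighborSet u = insert v (G.neighborSet u) := by
  ext x
  simp only [mem_neighborSet, sup_adj, fromEdgeSet_adj, Set.mem_singleton_iff, Sym2.eq_iff,
    Set.mem_insert_iff]
  grind

theorem neighborSet_sup_fromEdgeSet_of_ne (hwu : w ≠ u) (hwv : w ≠ v) :
    (G ⊔ fromEdgeSet {s(u, v)}).neighborSet w = G.neighborSet w := by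
  ext x
  simp only [mem_neighborSet, sup_adj, fromEdgeSet_adj, Set.mem_singleton_iff, Sym2.eq_iff]
  grind

end NewEdge

theorem Set.insert_symmDiff_of_notMem {α : Type*} {s t : Set α} {a : α} (ha : a ∉ t) :
    symmDiff (insert a s) t = insert a (symmDiff s t) := by
  ext x
  simp only [Set.mem_symmDiff, Set.mem_insert_iff]
  grind

theorem stmt6 {V : Type*} [Fintype V] (G H : SimpleGraph V) (u v w : V)
    (huv : u ≠ v) (hnadj : ¬ G.Adj u v)
    (hH : H = G ⊔ fromEdgeSet {s(u, v)})
    (hwu : w ∈ G.neighborSet u) (hwv : w ∉ G.neighborSet v)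
    (hdeg : (G.neighborSet u).ncard ≥ (G.neighborSet w).ncard) (hwne : w ≠ v) :
    ((symmDiff (G.neighborSet u) (G.neighborSet w)).ncard < (G.neighborSet u).ncard →
        NonAgreement G u w < NonAgreement H u w) ∧
      ((symmDiff (G.neighborSet u) (G.neighborSet w)).ncard = (G.neighborSet u).ncard →
        NonAgreement G u w = NonAgreement H u w) ∧
      ((symmDiff (G.neighborSet u) (G.neighborSet w)).ncard > (G.neighborSet u).ncard →
        NonAgreement G u w > NonAgreement H u w) := by
  have hvu : v ∉ G.neighborSet u := hnadj
  have hvw : v ∉ G.neighborSet w := fun h => hwv (G.adj_symm h)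
  have hpos : 0 < (G.neighborSet u).ncard := (Set.ncard_pos (Set.toFinite _)).2 ⟨w, hwu⟩
  have hvs : v ∉ symmDiff (G.neighborSet u) (G.neighborSet w) := by
    simp only [Set.mem_symmDiff]
    tauto
  subst hH
  simp only [NonAgreement, neighborSet_sup_fromEdgeSet_left huv,
    neighborSet_sup_fromEdgeSet_of_ne (G.ne_of_adj hwu).symm hwne,
    Set.insert_symmDiff_of_notMem hvw, Set.ncard_insert_of_notMem hvu (Set.toFinite _),
    Set.ncard_insert_of_notMem hvs (Set.toFinite _), max_eq_left hdeg,
    max_eq_left (hdeg.le.trans (Nat.le_succ _))]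
  generalize (symmDiff (G.neighborSet u) (G.neighborSet w)).ncard = t
  generalize (G.neighborSet u).ncard = d at hpos ⊢
  have hd : (0 : ℚ) < d := Nat.cast_pos.2 hpos
  push_cast
  refine ⟨fun h => ?_, fun h => ?_, fun h => ?_⟩
  · have : (t : ℚ) < d := Nat.cast_lt.2 h
    rw [div_lt_div_iff₀ hd (by positivity)]
    linarith
  · rw [h, div_self hd.ne', div_self (by positivity)]
  · have : (d : ℚ) < t := Nat.cast_lt.2 h
    rw [gt_iff_lt, div_lt_div_iff₀ (by positivity) hd]
    linarith
end

section
/- Suppose the sign of the edge {u,v} is flipped from − to +, and suppose u and w are in ε-agreement in G⁺. If either (a) w ∈ N_{G⁺}(u) ∩ N_{G⁺}(v), or (b) w ∈ N_{G⁺}(u) \ N_{G⁺}(v), w ≠ v, |N_{G⁺}(u)| ≥ |N_{G⁺}(w)|, and |N_{G⁺}(u) Δ N_{G⁺}(w)| ≥ |N_{G⁺}(u)|, then u and w are in ε-agreement in H⁺. -/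
open SimpleGraph

/-- Vertices `x` and `y` are in `ε`-agreement in `G` if they are adjacent
and `NonAgreement G x y < ε`. -/
def EpsAgree {V : Type*} [Fintype V] (ε : ℚ) (G : SimpleGraph V) (x y : V) : Prop :=
  G.Adj x y ∧ NonAgreement G x y < ε

theorem neighborSet_sup_edge_left {V : Type*} (G : SimpleGraph V) {u v : V} (huv : u ≠ v) :
    (G ⊔ fromEdgeSet {s(u, v)}).neighborSet u = insert v (G.neighborSet u) := by
  ext x
  simp only [mem_neighborSet, sup_adj, fromEdgeSet_adj, Set.mem_singleton_iff, Sym2.eq_iff,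
    Set.mem_insert_iff]
  grind

theorem neighborSet_sup_edge_of_ne {V : Type*} (G : SimpleGraph V) {u v w : V}
    (hu : w ≠ u) (hv : w ≠ v) :
    (G ⊔ fromEdgeSet {s(u, v)}).neighborSet w = G.neighborSet w := by
  ext x
  simp only [mem_neighborSet, sup_adj, fromEdgeSet_adj, Set.mem_singleton_iff, Sym2.eq_iff]
  grind

theorem stmt8 {V : Type*} [Fintype V] (G H : SimpleGraph V) (u v w : V) (ε : ℚ) (hε : 0 < ε)
    (huv : u ≠ v) (hnadj : ¬ G.Adj u v)
    (hH : H = G ⊔ fromEdgeSet {s(u, v)})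
    (hagree : EpsAgree ε G u w)
    (hcase : (w ∈ G.neighborSet u ∩ G.neighborSet v) ∨
      (w ∈ G.neighborSet u \ G.neighborSet v ∧ w ≠ v ∧
        (G.neighborSet u).ncard ≥ (G.neighborSet w).ncard ∧
        (symmDiff (G.neighborSet u) (G.neighborSet w)).ncard ≥ (G.neighborSet u).ncard)) :
    EpsAgree ε H u w := by
  obtain ⟨hadj, hlt⟩ := hagree
  have hwu : w ≠ u := hadj.ne'
  have hwv : w ≠ v := fun h => hnadj (h ▸ hadj)
  subst hH
  refine ⟨Or.inl hadj, lt_of_le_of_lt ?_ hlt⟩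
  have hvu : v ∉ G.neighborSet u := hnadj
  have hpos : 0 < (G.neighborSet u).ncard := (Set.ncard_pos).2 ⟨w, hadj⟩
  have hins : (insert v (G.neighborSet u)).ncard = (G.neighborSet u).ncard + 1 :=
    Set.ncard_insert_of_notMem hvu
  unfold NonAgreement
  rw [neighborSet_sup_edge_left G huv, neighborSet_sup_edge_of_ne G hwu hwv, hins]
  rcases hcase with ⟨-, hvw⟩ | ⟨⟨-, hvw⟩, -, hdeg, hdiff⟩
  · have hv : v ∈ G.neighborSet w := G.adj_symm hvw
    have hsub : symmDiff (insert v (G.neighborSet u)) (G.neighborSet w) ⊆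
        symmDiff (G.neighborSet u) (G.neighborSet w) := by
      intro x
      simp only [Set.mem_symmDiff, Set.mem_insert_iff]
      grind
    have hcard := Set.ncard_le_ncard hsub
    have hmax : (0 : ℚ) < (max (G.neighborSet u).ncard (G.neighborSet w).ncard : ℕ) := by
      exact_mod_cast lt_max_of_lt_left hpos
    gcongr
    exact Nat.le_succ _
  · have hv : v ∉ G.neighborSet w := fun h => hvw (G.adj_symm h)
    have hsymm : symmDiff (insert v (G.neighborSet u)) (G.neighborSet w) =
        insert v (symmDiff (G.neighborSet u) (G.neighborSet w)) := by
      ext x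
      simp only [Set.mem_symmDiff, Set.mem_insert_iff]
      grind
    have hvs : v ∉ symmDiff (G.neighborSet u) (G.neighborSet w) := by
      simp only [Set.mem_symmDiff]
      tauto
    rw [hsymm, Set.ncard_insert_of_notMem hvs, max_eq_left hdeg,
      max_eq_left (hdeg.trans (Nat.le_succ _))]
    have hpos' : (0 : ℚ) < (G.neighborSet u).ncard := by exact_mod_cast hpos
    have hdiff' : ((G.neighborSet u).ncard : ℚ) ≤
        (symmDiff (G.neighborSet u) (G.neighborSet w)).ncard := by exact_mod_cast hdiff
    push_cast
    rw [div_le_div_iff₀ (by positivity) hpos']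
    linarith
end

section
/- Suppose the sign of the edge {u,v} is flipped from − to +, and suppose w is adjacent to u in G⁺ but u and w are not in ε-agreement in G⁺ (i.e., NonAgreement_{G⁺}(u,w) ≥ ε). If either (a) w ∈ N_{G⁺}(u) \ N_{G⁺}(v), w ≠ v, and |N_{G⁺}(u)| < |N_{G⁺}(w)|, or (b) w ∈ N_{G⁺}(u) \ N_{G⁺}(v), w ≠ v, |N_{G⁺}(u)| ≥ |N_{G⁺}(w)|, and |N_{G⁺}(u) Δ N_{G⁺}(w)| < |N_{G⁺}(u)|, then u and w are not in ε-agreement in H⁺. -/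
open SimpleGraph

namespace SimpleGraph

variable {V : Type*} (G : SimpleGraph V) {u v w : V}

theorem neighborSet_sup_fromEdgeSet_pair (huv : u ≠ v) :
    (G ⊔ fromEdgeSet {s(u, v)}).neighborSet u = insert v (G.neighborSet u) := by
  ext x
  simp only [mem_neighborSet, sup_adj, fromEdgeSet_adj, Set.mem_singleton_iff, Sym2.eq_iff,
    Set.mem_insert_iff]
  grind

theorem neighborSet_sup_fromEdgeSet_pair_of_ne (hwu : w ≠ u) (hwv : w ≠ v) :
    (G ⊔ fromEdgeSet {s(u, v)}).neighborSet w = G.neighborSet w := by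
  ext x
  simp only [mem_neighborSet, sup_adj, fromEdgeSet_adj, Set.mem_singleton_iff, Sym2.eq_iff]
  grind

end SimpleGraph

theorem Set.symmDiff_insert_left {α : Type*} {s t : Set α} {a : α} (ht : a ∉ t) :
    symmDiff (insert a s) t = insert a (symmDiff s t) := by
  ext x
  simp only [Set.mem_symmDiff, Set.mem_insert_iff]
  grind

theorem stmt9 {V : Type*} [Fintype V] (G H : SimpleGraph V) (u v w : V) (ε : ℚ) (hε : 0 < ε)
    (huv : u ≠ v) (hnadj : ¬ G.Adj u v)
    (hH : H = G ⊔ fromEdgeSet {s(u, v)})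
    (hadjw : G.Adj u w) (hnagree : NonAgreement G u w ≥ ε)
    (hcase : (w ∈ G.neighborSet u \ G.neighborSet v ∧ w ≠ v ∧
        (G.neighborSet u).ncard < (G.neighborSet w).ncard) ∨
      (w ∈ G.neighborSet u \ G.neighborSet v ∧ w ≠ v ∧
        (G.neighborSet u).ncard ≥ (G.neighborSet w).ncard ∧
        (symmDiff (G.neighborSet u) (G.neighborSet w)).ncard < (G.neighborSet u).ncard)) :
    ¬ EpsAgree ε H u w := by
  rintro ⟨-, hlt⟩
  refine absurd hlt (not_lt.mpr (hnagree.trans ?_))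
  have hwv : w ≠ v := by tauto
  have hvw : v ∉ G.neighborSet w := fun h => by
    have : w ∉ G.neighborSet v := by rcases hcase with h | h <;> exact h.1.2
    exact this (G.adj_symm h)
  have hvu : v ∉ G.neighborSet u := hnadj
  have hvs : v ∉ symmDiff (G.neighborSet u) (G.neighborSet w) := by
    simp [Set.mem_symmDiff, hvw, hvu]
  unfold NonAgreement
  rw [hH, G.neighborSet_sup_fromEdgeSet_pair huv,
    G.neighborSet_sup_fromEdgeSet_pair_of_ne hadjw.ne' hwv, Set.symmDiff_insert_left hvw,
    Set.ncard_insert_of_notMem hvs (Set.toFinite _), Set.ncard_insert_of_notMem hvu (Set.toFinite _)]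
  rcases hcase with ⟨-, -, hdeg⟩ | ⟨-, -, hdeg, hsymm⟩
  · rw [max_eq_right hdeg.le, max_eq_right hdeg]
    gcongr
    exact Nat.le_succ _
  · rw [max_eq_left hdeg, max_eq_left (Nat.le_succ_of_le hdeg),
      div_le_div_iff₀ (by exact_mod_cast hsymm.pos) (by positivity)]
    have : ((symmDiff (G.neighborSet u) (G.neighborSet w)).ncard : ℚ) <
        (G.neighborSet u).ncard := by exact_mod_cast hsymm
    push_cast
    linarith
end

section
/- Suppose the sign of the edge {u,v} is flipped from + to −. If w ∈ N_{G⁺}(u) ∩ N_{G⁺}(v), then NonAgreement_{H⁺}(u,w) > NonAgreement_{G⁺}(u,w). -/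
open SimpleGraph

/-- Deleting the edge `{u, v}` removes exactly `v` from the neighborhood of `u`. -/
theorem neighborSet_deleteEdges_left {V : Type*} (G : SimpleGraph V) (u v : V) :
    (G.deleteEdges {s(u, v)}).neighborSet u = G.neighborSet u \ {v} := by
  ext x
  simp only [mem_neighborSet, deleteEdges_adj, Set.mem_singleton_iff, Set.mem_sdiff,
    Sym2.congr_right]

/-- Deleting the edge `{u, v}` leaves the neighborhoods of all other vertices unchanged. -/
theorem neighborSet_deleteEdges_of_ne {V : Type*} (G : SimpleGraph V) {u v w : V}
    (hu : w ≠ u) (hv : w ≠ v) :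
    (G.deleteEdges {s(u, v)}).neighborSet w = G.neighborSet w := by
  ext x
  simp only [mem_neighborSet, deleteEdges_adj, Set.mem_singleton_iff, Sym2.eq_iff]
  tauto

/-- Removing a common element of `s` and `t` from `s` adds it to the symmetric difference. -/
theorem ncard_symmDiff_sdiff_singleton {α : Type*} [Finite α] {s t : Set α} {a : α}
    (hs : a ∈ s) (ht : a ∈ t) :
    (symmDiff (s \ {a}) t).ncard = (symmDiff s t).ncard + 1 := by
  have h : symmDiff (s \ {a}) t = insert a (symmDiff s t) := by
    ext x
    by_cases hx : x = a
    · simp [Set.mem_symmDiff, hx, ht]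
    · simp [Set.mem_symmDiff, hx]
  rw [h, Set.ncard_insert_of_notMem (by simp [Set.mem_symmDiff, hs, ht])]

theorem stmt13 {V : Type*} [Fintype V] (G H : SimpleGraph V) (u v w : V)
    (huv : u ≠ v) (hadj : G.Adj u v)
    (hH : H = G.deleteEdges {s(u, v)})
    (hwu : w ∈ G.neighborSet u) (hwv : w ∈ G.neighborSet v) :
    NonAgreement H u w > NonAgreement G u w := by
  subst hH
  rw [mem_neighborSet] at hwu hwv
  have hpos : 0 < (G.neighborSet w).ncard := (Set.ncard_pos).2 ⟨u, hwu.symm⟩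
  have hle : (G.neighborSet u \ {v}).ncard ≤ (G.neighborSet u).ncard :=
    Set.ncard_le_ncard Set.sdiff_subset
  unfold NonAgreement
  rw [neighborSet_deleteEdges_left, neighborSet_deleteEdges_of_ne G hwu.ne' hwv.ne',
    ncard_symmDiff_sdiff_singleton (s := G.neighborSet u) (t := G.neighborSet w) hadj hwv.symm]
  refine div_lt_div₀ (by push_cast; linarith) ?_ (by positivity) ?_
  · exact_mod_cast max_le_max_right _ hle
  · exact_mod_cast lt_max_of_lt_right hpos
end

section
/- Suppose the sign of the edge {u,v} is flipped (in either direction), i.e., H⁺ is obtained from G⁺ by adding or deleting the single edge {u,v}. Let S = N_{G⁺}(u) ∪ N_{G⁺}(v) ∪ {u,v}. Then for every vertex w ∉ S with N_{G⁺}(w) ≠ ∅: w is ε-light in G⁺ if and only if w is ε-light in H⁺ (equivalently, if w is ε-light in G⁺ it remains ε-light in H⁺, and if w is not ε-light in G⁺ it is not ε-light in H⁺). -/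
open SimpleGraph

/-- `AgreeCnt ε G w` is the number of vertices in `ε`-agreement with `w` in `G`. -/
noncomputable def AgreeCnt {V : Type*} [Fintype V] (ε : ℚ) (G : SimpleGraph V) (w : V) : ℕ :=
  {x : V | EpsAgree ε G w x}.ncard

/-- A vertex `w` is `ε`-light in `G` if `AgreeCnt ε G w / |N_G(w)| < ε`. -/
noncomputable def IsLight {V : Type*} [Fintype V] (ε : ℚ) (G : SimpleGraph V) (w : V) : Prop :=
  ((AgreeCnt ε G w : ℚ) / ((G.neighborSet w).ncard : ℚ)) < ε

/-- Flipping the edge `{u, v}` changes no neighborhood other than those of `u` and `v`. -/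
theorem neighborSet_eq_of_flip {V : Type*} {G H : SimpleGraph V} {u v x : V}
    (hH : (¬ G.Adj u v ∧ H = G ⊔ fromEdgeSet {s(u, v)}) ∨
      (G.Adj u v ∧ H = G.deleteEdges {s(u, v)}))
    (hu : x ≠ u) (hv : x ≠ v) : H.neighborSet x = G.neighborSet x := by
  ext y
  rcases hH with ⟨-, rfl⟩ | ⟨-, rfl⟩ <;> simp [hu, hv]

/-- The lightness of `w` depends only on the neighborhoods of `w` and of its neighbors. -/
theorem isLight_congr {V : Type*} [Fintype V] {G H : SimpleGraph V} {w : V} (ε : ℚ)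
    (hw : H.neighborSet w = G.neighborSet w)
    (h : ∀ x, G.Adj w x → H.neighborSet x = G.neighborSet x) :
    IsLight ε G w ↔ IsLight ε H w := by
  have hagree : {x | EpsAgree ε H w x} = {x | EpsAgree ε G w x} := by
    ext x
    have hadj : H.Adj w x ↔ G.Adj w x := Set.ext_iff.mp hw x
    simp only [Set.mem_ofPred_eq, EpsAgree, hadj]
    refine and_congr_right fun hx => ?_
    rw [NonAgreement, NonAgreement, hw, h x hx]
  rw [IsLight, IsLight, AgreeCnt, AgreeCnt, hagree, hw]

theorem stmt19 {V : Type*} [Fintype V] (G H : SimpleGraph V) (u v : V) (ε : ℚ) (hε : 0 < ε)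
    (huv : u ≠ v)
    (hH : (¬ G.Adj u v ∧ H = G ⊔ fromEdgeSet {s(u, v)}) ∨
      (G.Adj u v ∧ H = G.deleteEdges {s(u, v)})) :
    ∀ w ∉ G.neighborSet u ∪ G.neighborSet v ∪ ({u, v} : Set V),
      G.neighborSet w ≠ ∅ → (IsLight ε G w ↔ IsLight ε H w) := by
  intro w hw _
  simp only [Set.mem_union, mem_neighborSet, Set.mem_insert_iff, Set.mem_singleton_iff,
    not_or] at hw
  obtain ⟨⟨huw, hvw⟩, hwu, hwv⟩ := hw
  refine isLight_congr ε (neighborSet_eq_of_flip hH hwu hwv) fun x hx => ?_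
  refine neighborSet_eq_of_flip hH ?_ ?_
  · rintro rfl
    exact huw hx.symm
  · rintro rfl
    exact hvw hx.symm
end
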